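/- arXiv:1810.12056 — 5 statements merged into one kernel-verified Lean document; each statement's English description precedes it below -/
import Mathlib

section
/- Let C ⊆ A be commutative rings, let D_1, …, D_N : A → A be (ℤ-linear) derivations with D_j(C) ⊆ C for all j, and let D'_i = Σ_{j=1}^N c_{ij} D_j (i = 1, …, N) with coefficients c_{ij} ∈ C. If the matrix (c_{ij})_{1 ≤ i,j ≤ N} is invertible over C (i.e. there is a matrix with entries in C inverse to it), then every finite composition of D_1, …, D_N can be written as a finite sum Σ_α c_α · M_α with c_α ∈ C acting by multiplication and each M_α a finite (possibly empty) composition of D'_1, …, D'_N. -/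
/-- Composition of the linear maps `f j` along a list of indices; the empty list gives the
identity. This encodes a "superposition" (finite composition) of the operators. -/
def compAlong {A : Type} [CommRing A] {N : ℕ} (f : Fin N → A →ₗ[ℤ] A) :
    List (Fin N) → (A →ₗ[ℤ] A)
  | [] => LinearMap.id
  | j :: l => (f j).comp (compAlong f l)

/-- If `D' = c D` and `b * c = 1`, then `D = b D'`. -/
theorem eq_sum_of_mul_eq_one {A : Type} [CommRing A] {N : ℕ} {b c : Matrix (Fin N) (Fin N) A}
    (hbc : b * c = 1) {v w : Fin N → A} (hw : ∀ i, w i = ∑ j, c i j * v j) (j : Fin N) :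
    v j = ∑ i, b j i * w i := by
  have h : w = c.mulVec v := funext hw
  have hv : v = b.mulVec w := by rw [h, Matrix.mulVec_mulVec, hbc, Matrix.one_mulVec]
  exact congrFun hv j

/-- The `C`-span of the compositions of operators `D'` is stable under a derivation `d` which
preserves `C` and is a `C`-linear combination of the `D'`. -/
theorem derivation_comp_mem_span_compAlong {A : Type} [CommRing A] {C : Subring A} {N : ℕ}
    {D' : Fin N → (A →ₗ[ℤ] A)} {d : Derivation ℤ A A} (hd : ∀ x ∈ C, d x ∈ C)
    {b : Fin N → A} (hb : ∀ i, b i ∈ C) (h : ∀ a, d a = ∑ i, b i * D' i a)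
    {f : A → A} (hf : f ∈ Submodule.span C (Set.range fun l => ⇑(compAlong D' l))) :
    (fun a => d (f a)) ∈ Submodule.span C (Set.range fun l => ⇑(compAlong D' l)) := by
  induction hf using Submodule.span_induction with
  | mem f hf =>
    obtain ⟨l, rfl⟩ := hf
    have key : (fun a => d (compAlong D' l a)) =
        ∑ i, (⟨b i, hb i⟩ : C) • ⇑(compAlong D' (i :: l)) := by
      ext a
      simp [h, compAlong, Subring.smul_def]
    simp only [key]
    exact Submodule.sum_mem _ fun i _ =>
      Submodule.smul_mem _ _ (Submodule.subset_span ⟨i :: l, rfl⟩)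
  | zero =>
    convert Submodule.zero_mem _ using 1
    ext a
    simp
  | add f g _ _ hf hg =>
    convert Submodule.add_mem _ hf hg using 1
    ext a
    simp
  | smul r f hf' hf =>
    convert Submodule.add_mem _ (Submodule.smul_mem _ r hf)
      (Submodule.smul_mem _ (⟨d r, hd r r.2⟩ : C) hf') using 1
    ext a
    simp [Subring.smul_def, mul_comm]

/-- if `D'_i = Σ_j c_{ij} D_j` with coefficient matrix `(c_{ij})` having entries in
`C` and invertible over `C`, then any finite composition of the `D_j` is a finite sum
`Σ_α c_α · M_α` with `c_α ∈ C` and `M_α` a finite composition of the `D'_i`. -/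
theorem stmt2 {A : Type} [CommRing A] (C : Subring A) {N : ℕ}
    (D : Fin N → Derivation ℤ A A)
    (hDC : ∀ j : Fin N, ∀ x ∈ C, D j x ∈ C)
    (c : Matrix (Fin N) (Fin N) A) (hc : ∀ i j, c i j ∈ C)
    (b : Matrix (Fin N) (Fin N) A) (hb : ∀ i j, b i j ∈ C)
    (hcb : c * b = 1) (hbc : b * c = 1)
    (D' : Fin N → (A →ₗ[ℤ] A))
    (hD' : ∀ (i : Fin N) (a : A), D' i a = ∑ j, c i j * D j a) :
    ∀ l : List (Fin N), ∃ (k : ℕ) (coef : Fin k → A) (M : Fin k → List (Fin N)),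
      (∀ α, coef α ∈ C) ∧
      ∀ a : A, compAlong (fun j => (D j).toLinearMap) l a =
        ∑ α, coef α * compAlong D' (M α) a := by
  intro l
  have hmem : ⇑(compAlong (fun j => (D j).toLinearMap) l) ∈
      Submodule.span C (Set.range fun l => ⇑(compAlong D' l)) := by
    induction l with
    | nil => exact Submodule.subset_span ⟨[], rfl⟩
    | cons j l ih =>
      exact derivation_comp_mem_span_compAlong (hDC j) (hb j)
        (fun a => eq_sum_of_mul_eq_one hbc (v := fun j => D j a) (fun i => hD' i a) j) ih
  obtain ⟨k, coef, g, hg⟩ := Submodule.mem_span_set'.1 hmem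
  choose M hM using fun α => (g α).2
  refine ⟨k, fun α => coef α, M, fun α => (coef α).2, fun a => ?_⟩
  simp [← hg, ← hM, Subring.smul_def]
end

section
/- Let B ⊆ A be commutative rings and let D̲ = (D_1, …, D_N) be derivations of A. Define B_{D̲} := {b ∈ B : D b ∈ B for every finite (possibly empty) composition D of D_1, …, D_N}; this is a subring of B. Suppose D'_i = Σ_{j=1}^N c_{ij} D_j (i = 1, …, N) where the matrix (c_{ij}) has entries in B_{D̲} and is invertible over B_{D̲} (there is a matrix with entries in B_{D̲} inverse to it). Then B_{D̲} = B_{D̲'}, where D̲' = (D'_1, …, D'_N). -/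
/-- For a subring `B ⊆ A` and a tuple of operators `D̲`, the set
`B_{D̲} = {b : every finite (possibly empty) composition of the `D_j` sends b into B}`. -/
def stableSet {A : Type} [CommRing A] (B : Subring A) {N : ℕ}
    (D : Fin N → (A →ₗ[ℤ] A)) : Set A :=
  {a : A | ∀ l : List (Fin N), compAlong D l a ∈ B}

theorem compAlong_append_singleton {A : Type} [CommRing A] {N : ℕ} (f : Fin N → A →ₗ[ℤ] A)
    (l : List (Fin N)) (j : Fin N) (a : A) :
    compAlong f (l ++ [j]) a = compAlong f l (f j a) := by
  induction l with
  | nil => rfl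
  | cons i l ih => simp [compAlong, ih]

theorem apply_mem_stableSet {A : Type} [CommRing A] {B : Subring A} {N : ℕ}
    {f : Fin N → A →ₗ[ℤ] A} {a : A} (ha : a ∈ stableSet B f) (j : Fin N) :
    f j a ∈ stableSet B f := fun l => by
  rw [← compAlong_append_singleton]
  exact ha _

/-- `stableSet B f` contains every subset of `B` that is preserved by all the `f j`. -/
theorem subset_stableSet {A : Type} [CommRing A] {B : Subring A} {N : ℕ}
    {f : Fin N → A →ₗ[ℤ] A} {T : Set A} (hT : T ⊆ B) (hf : ∀ j, ∀ a ∈ T, f j a ∈ T) :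
    T ⊆ stableSet B f := by
  intro a ha l
  suffices compAlong f l a ∈ T from hT this
  induction l with
  | nil => exact ha
  | cons j l ih => exact hf j _ ih

theorem mul_mem_stableSet {A : Type} [CommRing A] {B : Subring A} {N : ℕ}
    {D : Fin N → Derivation ℤ A A} {x y : A}
    (hx : x ∈ stableSet B fun j => (D j).toLinearMap)
    (hy : y ∈ stableSet B fun j => (D j).toLinearMap) :
    x * y ∈ stableSet B fun j => (D j).toLinearMap := by
  intro l
  induction l using List.reverseRecOn generalizing x y with
  | nil => exact B.mul_mem (hx []) (hy [])
  | append_singleton l j ih =>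
    have h : (D j).toLinearMap (x * y) =
        x * (D j).toLinearMap y + y * (D j).toLinearMap x := (D j).leibniz x y
    rw [compAlong_append_singleton, h, map_add]
    exact B.add_mem (ih hx (apply_mem_stableSet hy j)) (ih hy (apply_mem_stableSet hx j))

theorem sum_mem_stableSet {A : Type} [CommRing A] {B : Subring A} {N : ℕ}
    {f : Fin N → A →ₗ[ℤ] A} {ι : Type*} {s : Finset ι} {g : ι → A}
    (hg : ∀ i ∈ s, g i ∈ stableSet B f) : ∑ i ∈ s, g i ∈ stableSet B f := fun l => by
  rw [map_sum]
  exact B.sum_mem fun i hi => hg i hi l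

theorem stableSet_subset_of_eq_sum {A : Type} [CommRing A] {B : Subring A} {N : ℕ}
    {D : Fin N → Derivation ℤ A A} {c : Matrix (Fin N) (Fin N) A}
    (hc : ∀ i j, c i j ∈ stableSet B fun j => (D j).toLinearMap)
    {D' : Fin N → A →ₗ[ℤ] A} (hD' : ∀ i a, D' i a = ∑ j, c i j * D j a) :
    (stableSet B fun j => (D j).toLinearMap) ⊆ stableSet B D' := by
  refine subset_stableSet (fun a ha => ha []) fun i a ha => ?_
  rw [hD']
  exact sum_mem_stableSet fun j _ => mul_mem_stableSet (hc i j) (apply_mem_stableSet ha j)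

/-- if `D'_i = Σ_j c_{ij} D_j` where the matrix `(c_{ij})` has entries in `B_{D̲}`
and is invertible over `B_{D̲}`, then `B_{D̲} = B_{D̲'}`. -/
theorem stmt3 {A : Type} [CommRing A] (B : Subring A) {N : ℕ}
    (D : Fin N → Derivation ℤ A A)
    (c : Matrix (Fin N) (Fin N) A)
    (hc : ∀ i j, c i j ∈ stableSet B (fun j => (D j).toLinearMap))
    (b : Matrix (Fin N) (Fin N) A)
    (hb : ∀ i j, b i j ∈ stableSet B (fun j => (D j).toLinearMap))
    (hcb : c * b = 1) (hbc : b * c = 1)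
    (D' : Fin N → (A →ₗ[ℤ] A))
    (hD' : ∀ (i : Fin N) (a : A), D' i a = ∑ j, c i j * D j a) :
    stableSet B (fun j => (D j).toLinearMap) = stableSet B D' := by
  have hsub := stableSet_subset_of_eq_sum hc hD'
  refine hsub.antisymm ?_
  let E : Fin N → Derivation ℤ A A := fun i => ∑ j, c i j • D j
  have hE : ∀ i a, E i a = ∑ j, c i j * D j a := fun i a => by
    have h := map_sum (Derivation.coeFnAddMonoidHom (R := ℤ) (A := A) (M := A))
      (fun j => c i j • D j) Finset.univ
    exact (congrFun h a).trans (Finset.sum_apply a _ _)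
  obtain rfl : D' = fun i => (E i).toLinearMap := by
    ext i a
    exact (hD' i a).trans (hE i a).symm
  refine stableSet_subset_of_eq_sum (fun i j => hsub (hb i j)) fun i a => ?_
  have h : b.mulVec (c.mulVec fun j => D j a) = fun j => D j a := by
    rw [Matrix.mulVec_mulVec, hbc, Matrix.one_mulVec]
  simp only [hE]
  exact (congrFun h i).symm
end

section
/- Let k be a field and r ≥ 1. Every affine open subscheme U of the affine space 𝔸^r_k = Spec k[x_1, …, x_r] is a principal (basic) open subset: there exists a polynomial f ∈ k[x_1, …, x_r] such that U = D(f), the basic open subscheme of 𝔸^r_k defined by f. -/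
open AlgebraicGeometry

/-- In a unique factorization domain, `u` divides a power of `d` as soon as every prime divisor
of `u` divides `d`. -/
theorem exists_dvd_pow_of_forall_prime_dvd {A : Type*} [CommRing A] [IsDomain A]
    [UniqueFactorizationMonoid A] {u d : A} (hu : u ≠ 0)
    (h : ∀ p, Prime p → p ∣ u → p ∣ d) : ∃ n : ℕ, u ∣ d ^ n := by
  induction u using UniqueFactorizationMonoid.induction_on_prime with
  | h₁ => exact absurd rfl hu
  | h₂ x hx => exact ⟨0, hx.dvd⟩
  | h₃ a p ha hp ih =>
    obtain ⟨n, hn⟩ := ih ha fun q hq hqa => h q hq (hqa.mul_left p)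
    exact ⟨n + 1, pow_succ' d n ▸ mul_dvd_mul (h p hp (dvd_mul_right p a)) hn⟩

/-- Let `A` be a unique factorization domain inside a domain `B`. If an element `b` of `B` is a
fraction whose denominator may be chosen a power of `g` for every `g ∈ s`, then the denominator
may be chosen a power of any `d` divisible by all common divisors of `s`. -/
theorem exists_pow_mul_eq_of_forall_mem {A B : Type*} [CommRing A] [IsDomain A]
    [UniqueFactorizationMonoid A] [CommRing B] [IsDomain B] {φ : A →+* B}
    (hφ : Function.Injective φ) {s : Set A} (hs : ∃ g ∈ s, g ≠ 0) {d : A}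
    (hd : ∀ c, (∀ g ∈ s, c ∣ g) → c ∣ d) {b : B}
    (hb : ∀ g ∈ s, ∃ (n : ℕ) (a : A), φ g ^ n * b = φ a) :
    ∃ (n : ℕ) (a : A), φ d ^ n * b = φ a := by
  obtain ⟨g₀, hg₀, hne⟩ := hs
  obtain ⟨n, a, hna⟩ := hb g₀ hg₀
  obtain ⟨u, v, q, huv, hqu, hqv⟩ :=
    UniqueFactorizationMonoid.exists_reduced_factors (g₀ ^ n) (pow_ne_zero n hne) a
  have hqu0 : q * u ≠ 0 := hqu ▸ pow_ne_zero n hne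
  have hub : φ u * b = φ v := by
    refine mul_left_cancel₀ ((map_ne_zero_iff φ hφ).2 (left_ne_zero_of_mul hqu0)) ?_
    rw [← mul_assoc, ← map_mul, ← map_mul, hqu, hqv, map_pow, hna]
  have hu : ∀ g ∈ s, ∃ m : ℕ, u ∣ g ^ m := by
    intro g hg
    obtain ⟨m, c, hmc⟩ := hb g hg
    refine ⟨m, huv.dvd_of_dvd_mul_right ⟨c, hφ ?_⟩⟩
    rw [map_mul, map_mul, map_pow, ← hub, ← hmc]
    ring
  obtain ⟨m, w, hw⟩ := exists_dvd_pow_of_forall_prime_dvd (d := d) (right_ne_zero_of_mul hqu0)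
    fun p hp hpu => hd p fun g hg =>
      let ⟨_, hm⟩ := hu g hg
      hp.dvd_of_dvd_pow (hpu.trans hm)
  refine ⟨m, w * v, ?_⟩
  rw [← map_pow, hw, map_mul, map_mul, ← hub]
  ring

/-- If the image of an ideal `span s` generates the unit ideal in an extension `B` of `A` all of
whose elements are fractions with denominator a power of `d`, then `span s` contains a power
of `d`. -/
theorem exists_pow_mem_span {A B : Type*} [CommRing A] [CommRing B] {φ : A →+* B}
    (hφ : Function.Injective φ) {s : Set A} {d : A} (hs : Ideal.span (φ '' s) = ⊤)
    (hd : ∀ b : B, ∃ (n : ℕ) (a : A), φ d ^ n * b = φ a) :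
    ∃ n : ℕ, d ^ n ∈ Ideal.span s := by
  have key : ∀ x ∈ Ideal.span (φ '' s), ∃ (n : ℕ), ∃ a ∈ Ideal.span s, φ d ^ n * x = φ a := by
    intro x hx
    induction hx using Submodule.span_induction with
    | mem x hx =>
      obtain ⟨g, hg, rfl⟩ := hx
      exact ⟨0, g, Ideal.subset_span hg, by simp⟩
    | zero => exact ⟨0, 0, zero_mem _, by simp⟩
    | add x y _ _ hx hy =>
      obtain ⟨n, a, ha, hna⟩ := hx
      obtain ⟨m, c, hc, hmc⟩ := hy
      refine ⟨n + m, d ^ m * a + d ^ n * c,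
        add_mem (Ideal.mul_mem_left _ _ ha) (Ideal.mul_mem_left _ _ hc), ?_⟩
      rw [map_add, map_mul, map_mul, map_pow, map_pow, ← hna, ← hmc]
      ring
    | smul y x _ hx =>
      obtain ⟨n, a, ha, hna⟩ := hx
      obtain ⟨m, c, hmc⟩ := hd y
      refine ⟨n + m, c * a, Ideal.mul_mem_left _ _ ha, ?_⟩
      rw [map_mul, ← hna, ← hmc, smul_eq_mul]
      ring
  obtain ⟨n, a, ha, hna⟩ := key 1 (hs ▸ Submodule.mem_top)
  refine ⟨n, ?_⟩
  rwa [hφ (by simpa using hna : φ (d ^ n) = φ a)]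

/-- The basic open of a nonzero section over a reduced scheme is nonempty. -/
theorem nonempty_basicOpen {X : Scheme} [IsReduced X] {U : X.Opens} {g : Γ(X, U)} (hg : g ≠ 0) :
    Nonempty (X.basicOpen g) :=
  TopologicalSpace.Opens.nonempty_coeSort.2 ((TopologicalSpace.Opens.ne_bot_iff_nonempty _).1
    (mt (basicOpen_eq_bot_iff g).1 hg))

/-- A section over an open subset of an integral affine scheme becomes a global section after
multiplication by a power of `g`, for every `g` whose basic open is contained in the subset. -/
theorem exists_pow_mul_eq_map_of_basicOpen_le {X : Scheme} [IsIntegral X] [IsAffine X]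
    {U : X.Opens} (g : Γ(X, ⊤)) (hg : X.basicOpen g ≤ U) (b : Γ(X, U)) :
    ∃ (n : ℕ) (a : Γ(X, ⊤)), X.presheaf.map (CategoryTheory.homOfLE le_top).op g ^ n * b =
      X.presheaf.map (CategoryTheory.homOfLE (le_top : U ≤ ⊤)).op a := by
  by_cases h0 : g = 0
  · exact ⟨1, 0, by simp [h0]⟩
  have : Nonempty (X.basicOpen g) := nonempty_basicOpen h0
  obtain ⟨n, a, hna⟩ := exists_eq_pow_mul_of_isAffineOpen X ⊤ (isAffineOpen_top X) g
    (X.presheaf.map (CategoryTheory.homOfLE hg).op b)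
  refine ⟨n, a, map_injective_of_isIntegral X (CategoryTheory.homOfLE hg) ?_⟩
  have hcomp : ∀ c : Γ(X, ⊤), X.presheaf.map (CategoryTheory.homOfLE hg).op
      (X.presheaf.map (CategoryTheory.homOfLE (le_top : U ≤ ⊤)).op c) =
      X.presheaf.map (CategoryTheory.homOfLE (le_top : X.basicOpen g ≤ ⊤)).op c := fun c => by
    rw [← CategoryTheory.ConcreteCategory.comp_apply, ← X.presheaf.map_comp]
    rfl
  rw [map_mul, map_pow, hcomp, hcomp]
  exact hna.symm

/-- In an integral affine scheme whose ring of global sections is factorial, every affine open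
subset is a basic open subset. -/
theorem AlgebraicGeometry.IsAffineOpen.exists_eq_basicOpen {X : Scheme} [IsIntegral X] [IsAffine X]
    [UniqueFactorizationMonoid Γ(X, ⊤)] {U : X.Opens} (hU : IsAffineOpen U) :
    ∃ f : Γ(X, ⊤), U = X.basicOpen f := by
  obtain ⟨s, hsfin, hs⟩ := isCompact_and_isOpen_iff_finite_and_eq_biUnion_basicOpen.1
    ⟨hU.isCompact, U.isOpen⟩
  have hle : ∀ g ∈ s, X.basicOpen g ≤ U := fun g hg x hx =>
    hs.ge (Set.mem_biUnion hg hx)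
  by_cases h0 : ∃ g ∈ s, g ≠ 0
  swap
  · push Not at h0
    refine ⟨0, ?_⟩
    rw [Scheme.basicOpen_zero, eq_bot_iff]
    intro x hx
    obtain ⟨g, hg, hxg⟩ := Set.mem_iUnion₂.1 (hs.le hx)
    rwa [h0 g hg, Scheme.basicOpen_zero] at hxg
  have : Nonempty U := by
    obtain ⟨g, hg, hg0⟩ := h0
    exact (nonempty_basicOpen hg0).map (Set.inclusion (hle g hg))
  let φ : Γ(X, ⊤) →+* Γ(X, U) := (X.presheaf.map (CategoryTheory.homOfLE (le_top : U ≤ ⊤)).op).hom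
  have hφ : Function.Injective φ := map_injective_of_isIntegral X (CategoryTheory.homOfLE le_top)
  let _ : StrongNormalizationMonoid Γ(X, ⊤) :=
    UniqueFactorizationMonoid.strongNormalizationMonoid
  let _ := UniqueFactorizationMonoid.toNormalizedGCDMonoid Γ(X, ⊤)
  let d : Γ(X, ⊤) := hsfin.toFinset.gcd id
  have hspan : Ideal.span (φ '' s) = ⊤ := by
    rw [← hU.self_le_iSup_basicOpen_iff]
    intro x hx
    obtain ⟨g, hg, hxg⟩ := Set.mem_iUnion₂.1 (hs.le hx)
    refine TopologicalSpace.Opens.mem_iSup.2 ⟨⟨φ g, g, hg, rfl⟩, ?_⟩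
    exact (X.basicOpen_res g (CategoryTheory.homOfLE le_top).op).ge ⟨hx, hxg⟩
  obtain ⟨n, hn⟩ := exists_pow_mem_span hφ hspan fun b => exists_pow_mul_eq_of_forall_mem hφ h0
    (d := d) (fun c hc => Finset.dvd_gcd fun g hg => hc g (hsfin.mem_toFinset.1 hg))
    fun g hg => exists_pow_mul_eq_map_of_basicOpen_le g (hle g hg) b
  refine ⟨d, le_antisymm (fun x hx => ?_) (fun x hx => ?_)⟩
  · obtain ⟨g, hg, hxg⟩ := Set.mem_iUnion₂.1 (hs.le hx)
    obtain ⟨c, hc⟩ : d ∣ g := Finset.gcd_dvd (hsfin.mem_toFinset.2 hg)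
    rw [hc, Scheme.basicOpen_mul] at hxg
    exact hxg.1
  · by_contra hxU
    have hker : Ideal.span s ≤ (IsLocalRing.maximalIdeal (X.presheaf.stalk x)).comap
        (X.presheaf.germ ⊤ x trivial).hom := by
      refine Ideal.span_le.2 fun g hg => ?_
      exact fun hunit => hxU (hle g hg ((X.mem_basicOpen g x trivial).2 hunit))
    have := hker hn
    rw [Ideal.mem_comap, map_pow] at this
    exact (Ideal.IsPrime.mem_of_pow_mem inferInstance n this)
      ((X.mem_basicOpen d x trivial).1 hx)

/-- every affine open subscheme of the affine space
`𝔸ʳ_k = Spec k[x_1, …, x_r]` over a field `k` (with `r ≥ 1`) is a principal (basic) open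
subset `D(f)` for some polynomial `f`. -/
theorem stmt5 (k : Type) [Field k] (r : ℕ) (hr : 1 ≤ r)
    (U : (Spec (CommRingCat.of (MvPolynomial (Fin r) k))).Opens)
    (hU : IsAffineOpen U) :
    ∃ f : MvPolynomial (Fin r) k, U = PrimeSpectrum.basicOpen f := by
  let e := Scheme.ΓSpecIso (CommRingCat.of (MvPolynomial (Fin r) k))
  have := e.commRingCatIsoToRingEquiv.symm.toMulEquiv.uniqueFactorizationMonoid
    (inferInstanceAs (UniqueFactorizationMonoid (MvPolynomial (Fin r) k)))
  obtain ⟨f, hf⟩ := IsAffineOpen.exists_eq_basicOpen hU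
  exact ⟨e.hom f, hf.trans (basicOpen_eq_of_affine' f)⟩
end

section
/- Let g_1, …, g_s and f be polynomials in r real variables, and let W := {x ∈ ℝ^r : g_1(x) ≥ 0, …, g_s(x) ≥ 0} be the basic semialgebraic set they define. If f(x) > 0 for every x ∈ W, then there exists a polynomial g in r real variables such that f(x)^{-1} ≤ g(x) for all x ∈ W. -/
open Filter Topology Polynomial IntermediateField
open scoped IntermediateField.algebraAdjoinAdjoin

/-- Pulling germs back along a map, as a ring homomorphism. -/
def germPullback {X Y R : Type*} [CommRing R] {l : Filter X} {l' : Filter Y} (u : Y → X)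
    (hu : Tendsto u l' l) : Germ l R →+* Germ l' R where
  toFun a := a.compTendsto u hu
  map_one' := rfl
  map_zero' := rfl
  map_mul' a b := Germ.inductionOn₂ a b fun _ _ => rfl
  map_add' a b := Germ.inductionOn₂ a b fun _ _ => rfl

theorem exists_intermediateField_transcendental {F K : Type*} [Field F] [Field K] [Algebra F K]
    {m : K} (hm : Transcendental F m) :
    ∃ E : IntermediateField F K, Transcendental E m ∧ Algebra.IsAlgebraic E⟮m⟯ K := by
  obtain ⟨s, hms, hs⟩ := exists_isTranscendenceBasis_superset (R := F) (s := {m})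
    (by
      have := (algebraicIndependent_singleton_iff (R := F) (x := ((↑) : ({m} : Set K) → K))
        ⟨m, rfl⟩).2 hm
      exact this)
  have hm' : m ∈ s := hms rfl
  refine ⟨IntermediateField.adjoin F (s \ {m}), ?_, ?_⟩
  · have h := hs.1.transcendental_adjoin (s := {i | (i : K) ≠ m}) (i := ⟨m, hm'⟩) (by simp)
    have e : ((↑) : s → K) '' {i | (i : K) ≠ m} = s \ {m} := by
      ext y; simp [and_comm]
    rw [e] at h
    exact fun h' => h ((IsFractionRing.isAlgebraic_iff (Algebra.adjoin F (s \ {m}))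
      (IntermediateField.adjoin F (s \ {m})) K).2 h')
  · have := hs.isAlgebraic_field
    rw [Subtype.range_coe] at this
    set E := IntermediateField.adjoin F (s \ {m})
    have hle : IntermediateField.adjoin F s ≤ E⟮m⟯.restrictScalars F := by
      rw [adjoin_le_iff]
      intro y hy
      by_cases hym : y = m
      · exact hym ▸ mem_adjoin_simple_self E m
      · exact E⟮m⟯.algebraMap_mem (⟨y, subset_adjoin F _ ⟨hy, hym⟩⟩ : E)
    let : Algebra (IntermediateField.adjoin F s) E⟮m⟯ :=
      (IntermediateField.inclusion hle).toRingHom.toAlgebra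
    have : IsScalarTower (IntermediateField.adjoin F s) E⟮m⟯ K :=
      IsScalarTower.of_algebraMap_eq (congrFun rfl)
    exact Algebra.IsAlgebraic.tower_top (K := IntermediateField.adjoin F s) E⟮m⟯

section
variable {K : Type*} [Field K] [LinearOrder K] [IsStrictOrderedRing K] [TopologicalSpace K]
  [OrderTopology K]

theorem exists_ringHom_germ_of_transcendental {E : Type*} [Field E] [Algebra E K] {m : K}
    (hm : Transcendental E m) {l : Filter K} (hl : l ≤ 𝓝 m) :
    ∃ φ : E⟮m⟯ →+* Germ l K, φ (AdjoinSimple.gen E m) = ((id : K → K) : Germ l K) ∧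
      (∀ c : E, φ (algebraMap E E⟮m⟯ c) = ((fun _ => algebraMap E K c : K → K) : Germ l K)) ∧
      ∀ z, (φ z).Tendsto (𝓝 (z : K)) := by
  let ψ : E[X] →+* Germ l K := (Germ.coeRingHom l).comp
    (RingHom.pi fun y : K => (aeval y : E[X] →ₐ[E] K).toRingHom)
  have hψ : ∀ p : E[X], ψ p = ((fun y => aeval y p : K → K) : Germ l K) := fun p => rfl
  have hlim : ∀ p : E[X], Tendsto (fun y : K => aeval y p) l (𝓝 (aeval m p)) := fun p =>
    ((p.continuous_aeval).tendsto m).mono_left hl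
  have hunit : ∀ p : nonZeroDivisors E[X], IsUnit (ψ p) := by
    intro p
    have hp : aeval m (p : E[X]) ≠ 0 := fun h =>
      nonZeroDivisors.coe_ne_zero p ((transcendental_iff.1 hm) _ h)
    refine IsUnit.of_mul_eq_one ((fun y => (aeval y (p : E[X]))⁻¹ : K → K) : Germ l K) ?_
    rw [hψ, ← Germ.coe_mul, ← Germ.coe_one, Germ.coe_eq]
    filter_upwards [(hlim p).eventually_ne hp] with y hy
    exact mul_inv_cancel₀ hy
  let χ : RatFunc E →+* Germ l K := IsLocalization.lift hunit
  have hχ : ∀ p : E[X], χ (algebraMap E[X] (RatFunc E) p) = ψ p := fun p =>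
    IsLocalization.lift_eq hunit p
  have hχlim : ∀ u : RatFunc E, (χ u).Tendsto (𝓝 (aeval m u.num / aeval m u.denom)) := by
    intro u
    have hd : aeval m u.denom ≠ 0 := fun h => u.denom_ne_zero ((transcendental_iff.1 hm) _ h)
    have : χ u = ((fun y => aeval y u.num / aeval y u.denom : K → K) : Germ l K) := by
      have h1 : χ u * ψ u.denom = ψ u.num := by
        rw [← hχ, ← hχ, ← map_mul]
        exact congrArg χ ((div_eq_iff (by simpa using u.denom_ne_zero)).1 u.num_div_denom).symm
      have h2 := hunit ⟨u.denom, mem_nonZeroDivisors_of_ne_zero u.denom_ne_zero⟩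
      refine h2.mul_right_cancel (h1.trans ?_)
      simp only [hψ]
      rw [← Germ.coe_mul, Germ.coe_eq]
      filter_upwards [(hlim u.denom).eventually_ne hd] with y hy
      simp [hy]
    rw [this]
    exact (hlim _).div (hlim _) hd
  let e := RatFunc.algEquivOfTranscendental m hm
  refine ⟨χ.comp (e.symm : E⟮m⟯ →+* RatFunc E), ?_, ?_, ?_⟩
  · change χ (e.symm _) = _
    rw [RatFunc.algEquivOfTranscendental_symm_gen, ← RatFunc.algebraMap_X, hχ, hψ]
    simp; rfl
  · intro c
    change χ (e.symm _) = _
    rw [AlgEquiv.commutes, IsScalarTower.algebraMap_apply E E[X] (RatFunc E), hχ, hψ]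
    simp
  · intro z
    have := hχlim (e.symm z)
    rwa [← RatFunc.algEquivOfTranscendental_apply m hm, AlgEquiv.apply_symm_apply] at this

theorem frequently_root_near {X : Type*} {l : Filter X} [l.NeBot]
    (ivt : ∀ (p : K[X]) (a b : K), a ≤ b → p.eval a ≤ 0 → 0 ≤ p.eval b →
      ∃ c, a ≤ c ∧ c ≤ b ∧ p.eval c = 0)
    {p : K[X]} {θ : K} (hp : p.eval θ = 0) (hp' : p.derivative.eval θ ≠ 0) {P : X → K[X]}
    (hP : ∀ t, Tendsto (fun x => (P x).eval t) l (𝓝 (p.eval t))) :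
    ∃ᶠ z in l ×ˢ 𝓝 θ, (P z.1).eval z.2 = 0 := by
  obtain ⟨q, rfl⟩ := dvd_iff_isRoot.2 hp
  have hq : q.eval θ ≠ 0 := by simpa using hp'
  have hqpos : ∀ᶠ t in 𝓝 θ, 0 < q.eval t * q.eval θ :=
    ((q.continuous.mul continuous_const).tendsto θ).eventually_const_lt (mul_self_pos.2 hq)
  rw [frequently_iff]
  intro U hU
  obtain ⟨s, hs, v, hv, hsv⟩ := mem_prod_iff.1 hU
  obtain ⟨α, β, hαβ, hsub⟩ := mem_nhds_iff_exists_Ioo_subset.1 (inter_mem hv hqpos)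
  obtain ⟨a, ha, haθ⟩ := exists_between hαβ.1
  obtain ⟨b, hbθ, hb⟩ := exists_between hαβ.2
  have hin : ∀ c, a ≤ c → c ≤ b → c ∈ v ∩ {t | 0 < q.eval t * q.eval θ} := fun c h h' =>
    hsub ⟨ha.trans_le h, h'.trans_lt hb⟩
  have hA := ((hP a).mul_const (q.eval θ)).eventually_lt_const (u := 0) (by
    have := (hin a le_rfl (haθ.trans hbθ).le).2
    simp only [eval_mul, eval_sub, eval_X, eval_C, mul_assoc]
    exact mul_neg_of_neg_of_pos (sub_neg.2 haθ) this)
  have hB := ((hP b).mul_const (q.eval θ)).eventually_const_lt (u := 0) (by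
    have := (hin b (haθ.trans hbθ).le le_rfl).2
    simp only [eval_mul, eval_sub, eval_X, eval_C, mul_assoc]
    exact mul_pos (sub_pos.2 hbθ) this)
  obtain ⟨x, hxs, hxa, hxb⟩ := ((eventually_mem_set.2 hs).and (hA.and hB)).exists
  obtain ⟨c, hac, hcb, hc⟩ := ivt (P x * C (q.eval θ)) a b (haθ.trans hbθ).le
    (by simpa using hxa.le) (by simpa using hxb.le)
  refine ⟨(x, c), hsv ⟨hxs, (hin c hac hcb).1⟩, ?_⟩
  simpa [hq] using hc

/-- A field of germs with limits extends, after refining the filter, by any algebraic element. -/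
theorem exists_ringHom_germ_extension {ι : Type*} {l : Filter ι} [l.NeBot]
    (ivt : ∀ (p : K[X]) (a b : K), a ≤ b → p.eval a ≤ 0 → 0 ≤ p.eval b →
      ∃ c, a ≤ c ∧ c ≤ b ∧ p.eval c = 0)
    {L : Type*} [Field L] [CharZero L] [Algebra L K] (φ : L →+* Germ l K)
    (hφ : ∀ z, (φ z).Tendsto (𝓝 (algebraMap L K z))) {θ : K} (hθ : IsIntegral L θ) :
    ∃ (l' : Filter (ι × K)) (_ : l'.NeBot) (hl' : Tendsto Prod.fst l' l) (Φ : L[X] →+* Germ l' K),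
      (∀ z, Φ (C z) = (φ z).compTendsto Prod.fst hl') ∧ (∀ q, aeval θ q = 0 → Φ q = 0) ∧
      ∀ q, (Φ q).Tendsto (𝓝 (aeval θ q)) := by
  set μ := minpoly L θ
  have hrep : ∀ z, ∃ f : ι → K, φ z = (f : Germ l K) := fun z =>
    Germ.inductionOn (φ z) fun f => ⟨f, rfl⟩
  choose rep hrep using hrep
  have hreplim : ∀ z, Tendsto (rep z) l (𝓝 (algebraMap L K z)) := fun z => by
    simpa [hrep] using hφ z
  let P : ι → K[X] := fun x => ∑ k ∈ Finset.range (μ.natDegree + 1), C (rep (μ.coeff k) x) * X ^ k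
  have hPeval : ∀ x t, (P x).eval t =
      ∑ k ∈ Finset.range (μ.natDegree + 1), rep (μ.coeff k) x * t ^ k := fun x t => by
    simp [P, eval_finsetSum]
  have hfreq : ∃ᶠ z in l ×ˢ 𝓝 θ, (P z.1).eval z.2 = 0 := by
    refine frequently_root_near ivt (p := μ.map (algebraMap L K)) ?_ ?_ fun t => ?_
    · rw [eval_map_algebraMap]; exact minpoly.aeval L θ
    · rw [derivative_map, eval_map_algebraMap]
      exact (minpoly.irreducible hθ).separable.aeval_derivative_ne_zero (minpoly.aeval L θ)
    · simp only [hPeval]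
      rw [eval_map_algebraMap, aeval_eq_sum_range]
      simp only [Algebra.smul_def]
      exact tendsto_finsetSum _ fun k _ => (hreplim _).mul_const _
  let l' : Filter (ι × K) := (l ×ˢ 𝓝 θ) ⊓ 𝓟 {z | (P z.1).eval z.2 = 0}
  have hne : l'.NeBot := frequently_mem_iff_neBot.1 hfreq
  have hl' : Tendsto Prod.fst l' l := tendsto_fst.mono_left inf_le_left
  have hsnd : Tendsto Prod.snd l' (𝓝 θ) := tendsto_snd.mono_left inf_le_left
  let τ : Germ l' K := ((Prod.snd : ι × K → K) : Germ l' K)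
  let Φ : L[X] →+* Germ l' K := eval₂RingHom ((germPullback Prod.fst hl').comp φ) τ
  have hΦC : ∀ z, Φ (C z) = (φ z).compTendsto Prod.fst hl' := fun z => by
    simp [Φ]; rfl
  have hΦC' : ∀ z, Φ (C z) = ((fun w => rep z w.1 : ι × K → K) : Germ l' K) := fun z => by
    rw [hΦC, hrep]; rfl
  have hΦX : Φ X = τ := by simp [Φ]
  have hΦμ : Φ μ = 0 := by
    conv_lhs => rw [μ.as_sum_range_C_mul_X_pow]
    simp only [map_sum, map_mul, map_pow, hΦC', hΦX]
    have : (∑ k ∈ Finset.range (μ.natDegree + 1),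
        ((fun w => rep (μ.coeff k) w.1 : ι × K → K) : Germ l' K) * τ ^ k) =
        Germ.coeRingHom l' (∑ k ∈ Finset.range (μ.natDegree + 1),
          (fun w => rep (μ.coeff k) w.1 : ι × K → K) * Prod.snd ^ k) := by
      simp only [map_sum, map_mul, map_pow]; rfl
    rw [this]
    refine Germ.coe_eq.2 ?_
    filter_upwards [mem_inf_of_right (mem_principal_self _)] with w hw
    simpa [hPeval] using hw
  refine ⟨l', hne, hl', Φ, hΦC, fun q hq => ?_, fun q => ?_⟩
  · obtain ⟨r, rfl⟩ := minpoly.dvd L θ hq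
    rw [map_mul]
    change Φ μ * _ = 0
    rw [hΦμ, zero_mul]
  · induction q using Polynomial.induction_on' with
    | add p q hp hq =>
      rw [map_add, map_add]
      revert hp hq
      exact Germ.inductionOn₂ (Φ p) (Φ q) fun f g hf hg => Tendsto.add hf hg
    | monomial n z =>
      rw [← C_mul_X_pow_eq_monomial, map_mul, map_pow, hΦX, hΦC']
      simp only [map_mul, map_pow, aeval_C, aeval_X]
      exact ((hreplim z).comp hl').mul (hsnd.pow n)
end

theorem germ_aeval_eq {F L K ι σ : Type*} [Field F] [Field L] [Field K] [Algebra F K] [Algebra F L]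
    {l : Filter ι} (Φ : L[X] →+* Germ l K)
    (hΦ : ∀ c : F, Φ (C (algebraMap F L c)) =
      ((fun _ => algebraMap F K c : ι → K) : Germ l K))
    (q : σ → L[X]) (y : σ → ι → K) (hy : ∀ j, Φ (q j) = ((y j : ι → K) : Germ l K))
    (p : MvPolynomial σ F) : Φ (MvPolynomial.aeval q p) =
      ((fun w => MvPolynomial.aeval (fun j => y j w) p : ι → K) : Germ l K) := by
  induction p using MvPolynomial.induction_on with
  | C c =>
    simp only [MvPolynomial.aeval_C]
    exact hΦ c
  | add p p' hp hp' =>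
    simp only [map_add, hp, hp']
    rfl
  | mul_X p j hp =>
    simp only [map_mul, hp, MvPolynomial.aeval_X, hy]
    rfl

/-- The minimum of a polynomial on a basic closed semialgebraic set, when attained, is algebraic
over any field containing the coefficients. -/
theorem isAlgebraic_of_isMinOn {F K σ ι : Type*} [Field F] [Field K] [LinearOrder K]
    [IsStrictOrderedRing K] [Algebra F K] [Finite σ] [Finite ι]
    (ivt : ∀ (p : K[X]) (a b : K), a ≤ b → p.eval a ≤ 0 → 0 ≤ p.eval b →
      ∃ c, a ≤ c ∧ c ≤ b ∧ p.eval c = 0)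
    (f : MvPolynomial σ F) (h : ι → MvPolynomial σ F) (x : σ → K)
    (hx : ∀ i, 0 ≤ MvPolynomial.aeval x (h i))
    (hmin : ∀ y : σ → K, (∀ i, 0 ≤ MvPolynomial.aeval y (h i)) →
      MvPolynomial.aeval x f ≤ MvPolynomial.aeval y f) :
    IsAlgebraic F (MvPolynomial.aeval x f) := by
  by_contra hm
  let : TopologicalSpace K := Preorder.topology K
  have : OrderTopology K := ⟨rfl⟩
  set m := MvPolynomial.aeval x f
  obtain ⟨E, hE, hEK⟩ := exists_intermediateField_transcendental hm
  obtain ⟨φ, hφm, hφc, hφ⟩ := exists_ringHom_germ_of_transcendental (l := 𝓝[<] m) hE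
    nhdsWithin_le_nhds
  have : IsScalarTower F E⟮m⟯ K := IsScalarTower.of_algebraMap_eq fun _ => rfl
  have : CharZero E⟮m⟯ := (algebraMap E⟮m⟯ K).charZero_iff (algebraMap E⟮m⟯ K).injective |>.2
    inferInstance
  let M := IntermediateField.adjoin E⟮m⟯ (Set.range x)
  have : FiniteDimensional E⟮m⟯ M := finiteDimensional_adjoin fun y _ =>
    (hEK.isAlgebraic y).isIntegral
  let pb := Field.powerBasisOfFiniteOfSeparable E⟮m⟯ M
  have hq : ∀ j, ∃ q : E⟮m⟯[X], aeval (pb.gen : K) q = x j := fun j => by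
    obtain ⟨q, hq⟩ := pb.exists_eq_aeval' ⟨x j, subset_adjoin _ _ ⟨j, rfl⟩⟩
    refine ⟨q, ?_⟩
    have := congrArg (algebraMap M K) hq
    rw [← aeval_algebraMap_apply] at this
    exact this.symm
  choose q hq using hq
  obtain ⟨l', hne, hl', Φ, hΦC, hΦ0, hΦ⟩ := exists_ringHom_germ_extension ivt φ hφ
    (hEK.isAlgebraic (pb.gen : K)).isIntegral
  have hrep : ∀ j, ∃ y : K × K → K, Φ (q j) = (y : Germ l' K) := fun j =>
    Germ.inductionOn (Φ (q j)) fun y => ⟨y, rfl⟩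
  choose y hy using hrep
  have hval := germ_aeval_eq (F := F) Φ (fun c => by
    rw [hΦC, IsScalarTower.algebraMap_apply F E E⟮m⟯, hφc]; rfl) q y hy
  have hev : ∀ p : MvPolynomial σ F,
      aeval (pb.gen : K) (MvPolynomial.aeval q p) = MvPolynomial.aeval x p := fun p => by
    have := MvPolynomial.comp_aeval_apply q ((aeval (R := E⟮m⟯) (pb.gen : K)).restrictScalars F) p
    simpa [hq] using this
  have hf : ∀ᶠ w in l', MvPolynomial.aeval (fun j => y j w) f = w.1 := by
    rw [← EventuallyEq, ← Germ.coe_eq, ← hval]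
    have := hΦ0 (MvPolynomial.aeval q f - C (AdjoinSimple.gen E m)) (by simp [hev, m])
    rw [map_sub, sub_eq_zero, hΦC, hφm] at this
    exact this
  have hlt : ∀ᶠ w in l', w.1 < m := hl'.eventually self_mem_nhdsWithin
  have hh : ∀ᶠ w in l', ∀ i, 0 ≤ MvPolynomial.aeval (fun j => y j w) (h i) := by
    refine eventually_all.2 fun i => ?_
    rcases (hx i).eq_or_lt with h0 | hpos
    · have := hΦ0 (MvPolynomial.aeval q (h i)) (by rw [hev, ← h0])
      rw [hval] at this
      filter_upwards [Germ.coe_eq.1 (this.trans Germ.coe_zero.symm)] with w hw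
      exact hw.ge
    · have := hΦ (MvPolynomial.aeval q (h i))
      rw [hval, hev, Germ.coe_tendsto] at this
      exact (this.eventually_const_lt hpos).mono fun _ => le_of_lt
  obtain ⟨w, hwf, hwm, hwh⟩ := (hf.and (hlt.and hh)).exists
  exact (hmin _ hwh).not_gt (hwf ▸ hwm)

open Hyperreal

noncomputable instance : Algebra ℝ ℝ* := (Hyperreal.coeRingHom : ℝ →+* ℝ*).toAlgebra

/-- Passing from real sequences to hyperreals, as a ring homomorphism. -/
noncomputable def hyperrealOfSeqHom : (ℕ → ℝ) →+* ℝ* :=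
  Germ.coeRingHom (hyperfilter ℕ : Filter ℕ)

theorem hyperrealOfSeqHom_apply (u : ℕ → ℝ) : hyperrealOfSeqHom u = ofSeq u := rfl

theorem ofSeq_eq_ofSeq {u v : ℕ → ℝ} :
    ofSeq u = ofSeq v ↔ ∀ᶠ n in hyperfilter ℕ, u n = v n :=
  Germ.coe_eq

theorem ofSeq_mvPolynomial_aeval {σ : Type*} (v : σ → ℕ → ℝ) (p : MvPolynomial σ ℝ) :
    MvPolynomial.aeval (fun j => ofSeq (v j)) p =
      ofSeq fun n => MvPolynomial.eval (fun j => v j n) p := by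
  induction p using MvPolynomial.induction_on with
  | C c => simp only [MvPolynomial.aeval_C, MvPolynomial.eval_C]; rfl
  | add p q hp hq => simp only [map_add, hp, hq]; rfl
  | mul_X p j hp => simp only [map_mul, hp, MvPolynomial.aeval_X, MvPolynomial.eval_X]; rfl

theorem ofSeq_aeval (u : ℕ → ℝ) (p : ℝ[X]) :
    aeval (ofSeq u) p = ofSeq fun n => p.eval (u n) := by
  induction p using Polynomial.induction_on' with
  | add p q hp hq => simp only [map_add, eval_add, hp, hq]; rfl
  | monomial n c =>
    simp only [aeval_monomial, eval_monomial, ← hyperrealOfSeqHom_apply, ← map_pow]; rfl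

theorem hyperreal_polynomial_ivt (p : ℝ*[X]) (a b : ℝ*) (hab : a ≤ b) (ha : p.eval a ≤ 0)
    (hb : 0 ≤ p.eval b) : ∃ c, a ≤ c ∧ c ≤ b ∧ p.eval c = 0 := by
  choose rep hrep using ofSeq_surjective
  let P : ℕ → ℝ[X] := fun n =>
    ∑ k ∈ Finset.range (p.natDegree + 1), C (rep (p.coeff k) n) * X ^ k
  have hP : ∀ u : ℕ → ℝ, p.eval (ofSeq u) = ofSeq fun n => (P n).eval (u n) := fun u => by
    have : (fun n => (P n).eval (u n)) =
        ∑ k ∈ Finset.range (p.natDegree + 1), rep (p.coeff k) * u ^ k := by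
      ext n; simp [P, eval_finsetSum]
    rw [this, ← hyperrealOfSeqHom_apply (∑ k ∈ _, _), map_sum, eval_eq_sum_range]
    refine Finset.sum_congr rfl fun k _ => ?_
    rw [map_mul, map_pow, hyperrealOfSeqHom_apply, hyperrealOfSeqHom_apply, hrep]
  obtain ⟨u, rfl⟩ := ofSeq_surjective a
  obtain ⟨v, rfl⟩ := ofSeq_surjective b
  rw [hP] at ha hb
  have hroot : ∀ n, ∃ c, u n ≤ v n → (P n).eval (u n) ≤ 0 → 0 ≤ (P n).eval (v n) →
      u n ≤ c ∧ c ≤ v n ∧ (P n).eval c = 0 := fun n => by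
    by_cases h : u n ≤ v n ∧ (P n).eval (u n) ≤ 0 ∧ 0 ≤ (P n).eval (v n)
    · obtain ⟨c, hc, hc0⟩ := intermediate_value_Icc h.1 (P n).continuous.continuousOn h.2
      exact ⟨c, fun _ _ _ => ⟨hc.1, hc.2, hc0⟩⟩
    · exact ⟨0, fun h1 h2 h3 => (h ⟨h1, h2, h3⟩).elim⟩
  choose c hc using hroot
  have hall : ∀ᶠ n in hyperfilter ℕ, u n ≤ c n ∧ c n ≤ v n ∧ (P n).eval (c n) = 0 := by
    filter_upwards [ofSeq_le_ofSeq.1 hab, (ofSeq_le_ofSeq (g := fun _ => 0)).1 ha,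
      (ofSeq_le_ofSeq (f := fun _ => 0)).1 hb] with n h1 h2 h3
    exact hc n h1 h2 h3
  refine ⟨ofSeq c, ofSeq_le_ofSeq.2 (hall.mono fun _ h => h.1),
    ofSeq_le_ofSeq.2 (hall.mono fun _ h => h.2.1), ?_⟩
  rw [hP]
  exact ofSeq_eq_ofSeq.2 (hall.mono fun _ h => h.2.2)

/-- The elements of an ordered field bounded by powers of a fixed element `t ≥ 2`. -/
def polynomiallyBounded {K : Type*} [Field K] [LinearOrder K] [IsStrictOrderedRing K] (t : K)
    (ht : 2 ≤ t) : ValuationSubring K where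
  carrier := {a | ∃ N : ℕ, |a| ≤ t ^ N}
  mul_mem' := by
    rintro a b ⟨M, hM⟩ ⟨N, hN⟩
    refine ⟨M + N, ?_⟩
    rw [abs_mul, pow_add]
    gcongr
  one_mem' := ⟨0, by simp⟩
  add_mem' := by
    rintro a b ⟨M, hM⟩ ⟨N, hN⟩
    have h1 : (1 : K) ≤ t := one_le_two.trans ht
    refine ⟨M + N + 1, (abs_add_le a b).trans ?_⟩
    have hM' : t ^ M ≤ t ^ (M + N) := pow_le_pow_right₀ h1 (by omega)
    have hN' : t ^ N ≤ t ^ (M + N) := pow_le_pow_right₀ h1 (by omega)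
    calc |a| + |b| ≤ t ^ (M + N) * 2 := by linarith
      _ ≤ t ^ (M + N + 1) := by rw [pow_succ]; gcongr
  zero_mem' := ⟨0, by simp⟩
  neg_mem' := by
    rintro a ⟨N, hN⟩
    exact ⟨N, by rwa [abs_neg]⟩
  mem_or_inv_mem' a := by
    rcases le_total |a| 1 with h | h
    · exact Or.inl ⟨0, by simpa using h⟩
    · exact Or.inr ⟨0, by simpa [abs_inv] using inv_le_one_of_one_le₀ h⟩

theorem mem_polynomiallyBounded {K : Type*} [Field K] [LinearOrder K] [IsStrictOrderedRing K]
    {t : K} {ht : 2 ≤ t} {a : K} : a ∈ polynomiallyBounded t ht ↔ ∃ N : ℕ, |a| ≤ t ^ N :=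
  Iff.rfl

theorem ValuationSubring.mem_of_isAlgebraic {F K : Type*} [Field F] [Field K] [Algebra F K]
    (A : ValuationSubring K) (hA : ∀ c : F, algebraMap F K c ∈ A) {a : K}
    (ha : IsAlgebraic F a) : a ∈ A := by
  let ι : F →+* A := (algebraMap F K).codRestrict A hA
  obtain ⟨p, hp, hpa⟩ := ha.isIntegral
  have : IsIntegral A a := by
    refine ⟨p.map ι, hp.map ι, ?_⟩
    rw [eval₂_map]
    exact hpa
  obtain ⟨y, rfl⟩ := IsIntegrallyClosed.algebraMap_eq_of_integral this
  exact y.2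

theorem Polynomial.exists_pos_forall_eventually_le_abs_eval {q : ℝ[X]} (hq : q ≠ 0) :
    ∃ δ > 0, ∀ᶠ x in atTop, δ ≤ |q.eval x| := by
  by_cases hd : 0 < q.degree
  · exact ⟨1, one_pos, (q.abs_tendsto_atTop hd).eventually_ge_atTop 1⟩
  · obtain ⟨c, rfl⟩ : ∃ c, q = C c := ⟨_, eq_C_of_degree_le_zero (not_lt.1 hd)⟩
    exact ⟨|c|, abs_pos.2 fun h => hq (by simp [h]), by simp⟩

theorem adjoin_ofSeq_subset_polynomiallyBounded {u : ℕ → ℝ}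
    (hu : Tendsto u (hyperfilter ℕ : Filter ℕ) atTop) (ht : 2 ≤ ofSeq u) {a : ℝ*}
    (ha : a ∈ ℝ⟮ofSeq u⟯) : a ∈ polynomiallyBounded (ofSeq u) ht := by
  have hconst : ∀ c : ℝ, algebraMap ℝ ℝ* c ∈ polynomiallyBounded (ofSeq u) ht := fun c => by
    refine ⟨1, ?_⟩
    rw [pow_one]
    change |((c : ℝ) : ℝ*)| ≤ _
    rw [← coe_abs]
    exact ofSeq_le_ofSeq.2 (hu.eventually_ge_atTop |c|)
  have hmem : ofSeq u ∈ polynomiallyBounded (ofSeq u) ht :=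
    ⟨1, by rw [pow_one, abs_of_nonneg (zero_le_two.trans ht)]⟩
  have hpoly : ∀ p : ℝ[X], aeval (ofSeq u) p ∈ polynomiallyBounded (ofSeq u) ht := fun p => by
    rw [aeval_eq_sum_range]
    exact sum_mem fun k _ => by
      rw [Algebra.smul_def]
      exact mul_mem (hconst _) (pow_mem hmem k)
  obtain ⟨p, q, rfl⟩ := (mem_adjoin_simple_iff ℝ a).1 ha
  rw [div_eq_mul_inv]
  refine mul_mem (hpoly p) ?_
  rcases eq_or_ne q 0 with rfl | hq
  · simp
  obtain ⟨δ, hδ, hq⟩ := exists_pos_forall_eventually_le_abs_eval hq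
  refine ⟨1, ?_⟩
  rw [pow_one, ofSeq_aeval]
  change ofSeq (fun n => |(q.eval (u n))⁻¹|) ≤ _
  refine ofSeq_le_ofSeq.2 ?_
  filter_upwards [hu.eventually hq, hu.eventually_ge_atTop δ⁻¹] with n h1 h2
  rw [abs_inv]
  exact (inv_anti₀ hδ h1).trans h2

theorem exists_isMinOn_sublevel {r s : ℕ} (g : Fin s → MvPolynomial (Fin r) ℝ)
    (f : MvPolynomial (Fin r) ℝ) {t : ℝ} (ht : 1 ≤ t) {x : Fin r → ℝ}
    (hx : ∀ i, 0 ≤ MvPolynomial.eval x (g i)) (hxt : ∑ j, x j ^ 2 ≤ t) :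
    ∃ z : Fin r → ℝ, (∀ i, 0 ≤ MvPolynomial.eval z (g i)) ∧ ∑ j, z j ^ 2 ≤ t ∧
      ∀ y : Fin r → ℝ, (∀ i, 0 ≤ MvPolynomial.eval y (g i)) → ∑ j, y j ^ 2 ≤ t →
        MvPolynomial.eval z f ≤ MvPolynomial.eval y f := by
  let S : Set (Fin r → ℝ) := {y | (∀ i, 0 ≤ MvPolynomial.eval y (g i)) ∧ ∑ j, y j ^ 2 ≤ t}
  have hclosed : IsClosed S := by
    refine IsClosed.inter (s₁ := {y | ∀ i, 0 ≤ MvPolynomial.eval y (g i)}) ?_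
      (isClosed_le (f := fun y : Fin r → ℝ => ∑ j, y j ^ 2) (by fun_prop) continuous_const)
    simp only [Set.ofPred_forall]
    exact isClosed_iInter fun i =>
      isClosed_le continuous_const (MvPolynomial.continuous_eval (g i))
  have hcompact : IsCompact S := by
    refine (isCompact_Icc (a := fun _ => -t) (b := fun _ => t)).of_isClosed_subset hclosed ?_
    intro y hy
    have hj : ∀ j, |y j| ≤ t := fun j => by
      refine abs_le_of_sq_le_sq ?_ (by linarith)
      have := Finset.single_le_sum (fun k _ => sq_nonneg (y k)) (Finset.mem_univ j)
      nlinarith [hy.2]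
    exact ⟨fun j => (abs_le.1 (hj j)).1, fun j => (abs_le.1 (hj j)).2⟩
  obtain ⟨z, hz, hmin⟩ := hcompact.exists_isMinOn ⟨x, hx, hxt⟩
    (MvPolynomial.continuous_eval f).continuousOn
  exact ⟨z, hz.1, hz.2, fun y hy hyt => hmin ⟨hy, hyt⟩⟩

/-- corollary of Krivine's Positivstellensatz: if a real polynomial `f` in `r`
variables is strictly positive on the basic semialgebraic set
`W = {x ∈ ℝ^r : g_1(x) ≥ 0, …, g_s(x) ≥ 0}`, then `f⁻¹` is bounded on `W` by a polynomial. -/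
theorem stmt6 (r s : ℕ) (g : Fin s → MvPolynomial (Fin r) ℝ)
    (f : MvPolynomial (Fin r) ℝ)
    (hf : ∀ x : Fin r → ℝ, (∀ i, 0 ≤ MvPolynomial.eval x (g i)) →
      0 < MvPolynomial.eval x f) :
    ∃ p : MvPolynomial (Fin r) ℝ, ∀ x : Fin r → ℝ,
      (∀ i, 0 ≤ MvPolynomial.eval x (g i)) →
      (MvPolynomial.eval x f)⁻¹ ≤ MvPolynomial.eval x p := by
  by_contra! hcon
  choose x hx hxf using fun n : ℕ =>
    hcon ((MvPolynomial.C ((n : ℝ) + 2) + ∑ j, MvPolynomial.X j ^ 2) ^ n)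
  let t : ℕ → ℝ := fun n => (n : ℝ) + 2 + ∑ j, x n j ^ 2
  have hxt : ∀ n, t n ^ n < (MvPolynomial.eval (x n) f)⁻¹ := fun n => by
    simpa [t] using hxf n
  have hsq : ∀ n, 0 ≤ ∑ j, x n j ^ 2 := fun n => Finset.sum_nonneg fun j _ => sq_nonneg _
  have htn : ∀ n : ℕ, (n : ℝ) + 2 ≤ t n := fun n => by simp only [t]; linarith [hsq n]
  have ht2 : ∀ n, 2 ≤ t n := fun n => by linarith [htn n, n.cast_nonneg (α := ℝ)]
  choose z hz hzt hzmin using fun n => exists_isMinOn_sublevel g f (t := t n)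
    (one_le_two.trans (ht2 n)) (hx n)
    (by simp only [t]; linarith [n.cast_nonneg (α := ℝ)])
  have ht : 2 ≤ ofSeq t := (ofSeq_le_ofSeq (f := fun _ => 2)).2 (Eventually.of_forall ht2)
  have htop : Tendsto t (hyperfilter ℕ : Filter ℕ) atTop :=
    (tendsto_atTop_mono (fun n => by linarith [htn n])
      tendsto_natCast_atTop_atTop).mono_left Nat.hyperfilter_le_atTop
  let F := ℝ⟮ofSeq t⟯
  let h : Option (Fin s) → MvPolynomial (Fin r) F := fun o =>
    o.elim (MvPolynomial.C (AdjoinSimple.gen ℝ (ofSeq t)) - ∑ j, MvPolynomial.X j ^ 2)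
      fun i => MvPolynomial.map (algebraMap ℝ F) (g i)
  let Z : Fin r → ℝ* := fun j => ofSeq fun n => z n j
  have hfeas : ∀ v : Fin r → ℕ → ℝ,
      (∀ o, 0 ≤ MvPolynomial.aeval (fun j => ofSeq (v j)) (h o)) ↔
      ∀ᶠ n in hyperfilter ℕ, (∀ i, 0 ≤ MvPolynomial.eval (fun j => v j n) (g i)) ∧
        ∑ j, v j n ^ 2 ≤ t n := fun v => by
    rw [Option.forall, and_comm, eventually_and, eventually_all]
    have hnorm : ∑ j, ofSeq (v j) ^ 2 = ofSeq fun n => ∑ j, v j n ^ 2 := by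
      have : (fun n => ∑ j, v j n ^ 2) = ∑ j, v j ^ 2 := by ext n; simp
      rw [this, ← hyperrealOfSeqHom_apply, map_sum]
      rfl
    refine and_congr (forall_congr' fun i => ?_) ?_
    · simp only [h, Option.elim_some, MvPolynomial.aeval_map_algebraMap,
        ofSeq_mvPolynomial_aeval]
      exact ofSeq_le_ofSeq (f := fun _ => 0)
    · simp only [h, Option.elim_none, map_sub, map_sum, map_pow, MvPolynomial.aeval_C,
        MvPolynomial.aeval_X, sub_nonneg, hnorm]
      exact ofSeq_le_ofSeq
  have hval : ∀ v : Fin r → ℕ → ℝ, MvPolynomial.aeval (fun j => ofSeq (v j))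
      (MvPolynomial.map (algebraMap ℝ F) f) =
        ofSeq fun n => MvPolynomial.eval (fun j => v j n) f := fun v => by
    rw [MvPolynomial.aeval_map_algebraMap, ofSeq_mvPolynomial_aeval]
  have halg := isAlgebraic_of_isMinOn hyperreal_polynomial_ivt
    (MvPolynomial.map (algebraMap ℝ F) f) h Z
    ((hfeas _).2 (Eventually.of_forall fun n => ⟨hz n, hzt n⟩)) fun y hy => by
      choose v hv using fun j => ofSeq_surjective (y j)
      obtain rfl : (fun j => ofSeq (v j)) = y := funext hv
      rw [hval, hval]
      exact ofSeq_le_ofSeq.2 (((hfeas v).1 hy).mono fun n hn => hzmin n _ hn.1 hn.2)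
  rw [hval] at halg
  obtain ⟨N, hN⟩ := mem_polynomiallyBounded.1 <|
    (polynomiallyBounded (ofSeq t) ht).mem_of_isAlgebraic
      (fun c => adjoin_ofSeq_subset_polynomiallyBounded htop ht c.2) halg.inv
  have hN' : ∀ᶠ n in hyperfilter ℕ, |(MvPolynomial.eval (z n) f)⁻¹| ≤ t n ^ N :=
    ofSeq_le_ofSeq.1 hN
  obtain ⟨n, hn, hNn⟩ := (hN'.and (Nat.hyperfilter_le_atTop (eventually_ge_atTop N))).exists
  have h1 : (MvPolynomial.eval (x n) f)⁻¹ ≤ (MvPolynomial.eval (z n) f)⁻¹ :=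
    inv_anti₀ (hf _ (hz n)) (hzmin n _ (hx n) (by
      simp only [t]; linarith [n.cast_nonneg (α := ℝ)]))
  have h2 : t n ^ N ≤ t n ^ n := pow_le_pow_right₀ (one_le_two.trans (ht2 n)) hNn
  linarith [hxt n, le_abs_self (MvPolynomial.eval (z n) f)⁻¹]
end

section
/- Let X, Y be Banach spaces, A : X ⇸ Y a closed linear operator, and B : X ⇸ X, C : Y ⇸ Y densely defined linear operators, each satisfying the Hille–Yosida condition. Let (e^{tB})_{t ≥ 0} and (e^{tC})_{t ≥ 0} be C₀-semigroups on X and Y whose generators are exactly B and C respectively. Suppose Dom(B) ⊆ Dom(A), and that C ∘ A extends A ∘ B, i.e. for every x ∈ Dom(B) with Bx ∈ Dom(A) one has Ax ∈ Dom(C) and C(Ax) = A(Bx). Then for every t > 0 and every x ∈ Dom(A): e^{tB} x ∈ Dom(A) and A(e^{tB} x) = e^{tC}(A x). -/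
open Filter Topology Set

/-- `S` is a C₀-semigroup of bounded operators on `X` (only the values `S t` for `t ≥ 0`
matter). -/
def IsC0Semigroup {X : Type} [NormedAddCommGroup X] [NormedSpace ℝ X]
    (S : ℝ → X →L[ℝ] X) : Prop :=
  S 0 = ContinuousLinearMap.id ℝ X ∧
  (∀ s t : ℝ, 0 ≤ s → 0 ≤ t → S (s + t) = (S s).comp (S t)) ∧
  ∀ x : X, Tendsto (fun t => S t x) (𝓝[>] (0 : ℝ)) (𝓝 x)

/-- `x` belongs to the domain of the generator of `S` and the generator takes the value `y`
at `x`, i.e. `(S h x − x)/h → y` as `h → 0⁺`. -/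
def InGenerator {X : Type} [NormedAddCommGroup X] [NormedSpace ℝ X]
    (S : ℝ → X →L[ℝ] X) (x y : X) : Prop :=
  Tendsto (fun h : ℝ => h⁻¹ • (S h x - x)) (𝓝[>] (0 : ℝ)) (𝓝 y)

/-- The (possibly unbounded) operator `G` is exactly the generator of the semigroup `S`:
its domain consists precisely of the vectors where the defining limit exists, and `G` is
given by that limit. -/
def IsGenerator {X : Type} [NormedAddCommGroup X] [NormedSpace ℝ X]
    (S : ℝ → X →L[ℝ] X) (G : X →ₗ.[ℝ] X) : Prop :=
  (∀ x : G.domain, InGenerator S (x : X) (G x)) ∧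
  ∀ x : X, (∃ y, InGenerator S x y) → x ∈ G.domain

/-- The Hille–Yosida condition for a densely defined operator `G`: there is `λ₀ ∈ ℝ` such
that every `λ > λ₀` lies in the resolvent set of `G` and `‖(λ − G)⁻¹‖ ≤ 1/(λ − λ₀)`
(the norm bound being expressed as `(λ − λ₀)·‖x‖ ≤ ‖λ•x − Gx‖`, which also forces the
injectivity of `λ − G`). -/
def HilleYosida {X : Type} [NormedAddCommGroup X] [NormedSpace ℝ X]
    (G : X →ₗ.[ℝ] X) : Prop :=
  Dense (G.domain : Set X) ∧ ∃ l0 : ℝ, ∀ l : ℝ, l0 < l →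
    (∀ y : X, ∃ x : G.domain, l • (x : X) - G x = y) ∧
    ∀ x : G.domain, (l - l0) * ‖(x : X)‖ ≤ ‖l • (x : X) - G x‖

section Semigroup

variable {X Y : Type} [NormedAddCommGroup X] [NormedSpace ℝ X]
  [NormedAddCommGroup Y] [NormedSpace ℝ Y]

lemma IsC0Semigroup.tendsto_nhdsGE {S : ℝ → X →L[ℝ] X} (hS : IsC0Semigroup S) (x : X) :
    Tendsto (fun t => S t x) (𝓝[≥] (0 : ℝ)) (𝓝 x) := by
  have h : ContinuousWithinAt (fun t => S t x) (Ioi 0) 0 := by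
    simpa [ContinuousWithinAt, hS.1] using hS.2.2 x
  simpa [ContinuousWithinAt, hS.1] using continuousWithinAt_Ioi_iff_Ici.1 h

lemma IsC0Semigroup.exists_norm_le_near_zero [CompleteSpace X] {S : ℝ → X →L[ℝ] X}
    (hS : IsC0Semigroup S) : ∃ a > 0, ∃ M, ∀ t ∈ Icc 0 a, ‖S t‖ ≤ M := by
  by_contra! hcon
  choose u hu hlarge using fun n : ℕ =>
    hcon (1 / ((n : ℝ) + 1)) Nat.one_div_pos_of_nat (n : ℝ)
  have hu0 : Tendsto u atTop (𝓝[≥] (0 : ℝ)) :=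
    tendsto_nhdsWithin_iff.2 ⟨squeeze_zero (fun n => (hu n).1) (fun n => (hu n).2)
      tendsto_one_div_add_atTop_nhds_zero_nat, Eventually.of_forall fun n => (hu n).1⟩
  obtain ⟨K, hK⟩ := banach_steinhaus (g := fun n => S (u n)) fun x => by
    obtain ⟨K, hK⟩ := ((hS.tendsto_nhdsGE x).comp hu0).norm.bddAbove_range
    exact ⟨K, fun n => hK ⟨n, rfl⟩⟩
  obtain ⟨n, hn⟩ := exists_nat_gt K
  exact lt_irrefl _ ((hn.trans (hlarge n)).trans_le (hK n))

lemma IsC0Semigroup.exists_norm_le [CompleteSpace X] {S : ℝ → X →L[ℝ] X}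
    (hS : IsC0Semigroup S) (T : ℝ) : ∃ M, ∀ t ∈ Icc 0 T, ‖S t‖ ≤ M := by
  obtain ⟨a, ha, M, hM⟩ := hS.exists_norm_le_near_zero
  have key : ∀ n : ℕ, ∃ M, ∀ t ∈ Icc 0 (2 ^ n * a), ‖S t‖ ≤ M := by
    intro n
    induction n with
    | zero => exact ⟨M, by simpa using hM⟩
    | succ n ih =>
      obtain ⟨K, hK⟩ := ih
      refine ⟨K * K, fun t ht => ?_⟩
      have ht2 : t / 2 ∈ Icc 0 (2 ^ n * a) := by
        constructor
        · linarith [ht.1]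
        · have := ht.2
          rw [pow_succ] at this
          linarith
      have hK0 : 0 ≤ K := (norm_nonneg _).trans (hK _ ht2)
      rw [← add_halves t, hS.2.1 _ _ ht2.1 ht2.1]
      exact (ContinuousLinearMap.opNorm_comp_le _ _).trans
        (mul_le_mul (hK _ ht2) (hK _ ht2) (norm_nonneg _) hK0)
  obtain ⟨n, hn⟩ := pow_unbounded_of_one_lt (T / a) one_lt_two
  obtain ⟨K, hK⟩ := key n
  exact ⟨K, fun t ht => hK t ⟨ht.1, ht.2.trans ((div_lt_iff₀ ha).1 hn).le⟩⟩

lemma IsC0Semigroup.continuousOn_apply [CompleteSpace X] {S : ℝ → X →L[ℝ] X}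
    (hS : IsC0Semigroup S) (T : ℝ) (x : X) : ContinuousOn (fun t => S t x) (Icc 0 T) := by
  obtain ⟨M, hM⟩ := hS.exists_norm_le T
  have key : ∀ r s, 0 ≤ r → r ≤ s → r ≤ T → ‖S s x - S r x‖ ≤ M * ‖S |s - r| x - x‖ := by
    intro r s hr hrs hrT
    have : S s x - S r x = S r (S |s - r| x - x) := by
      rw [map_sub, abs_of_nonneg (sub_nonneg.2 hrs), ← ContinuousLinearMap.comp_apply,
        ← hS.2.1 _ _ hr (sub_nonneg.2 hrs), add_sub_cancel]
    rw [this]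
    exact (S r).le_of_opNorm_le (hM r ⟨hr, hrT⟩) _
  intro s hs
  have habs : Tendsto (fun r => |r - s|) (𝓝[Icc 0 T] s) (𝓝[≥] (0 : ℝ)) := by
    refine tendsto_nhdsWithin_iff.2 ⟨?_, Eventually.of_forall fun r => mem_Ici.2 (abs_nonneg _)⟩
    have h : Tendsto (fun r : ℝ => |r - s|) (𝓝 s) (𝓝 |s - s|) := Continuous.tendsto (by fun_prop) s
    rw [sub_self, abs_zero] at h
    exact h.mono_left nhdsWithin_le_nhds
  have hlim : Tendsto (fun r => M * ‖S |r - s| x - x‖) (𝓝[Icc 0 T] s) (𝓝 0) := by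
    simpa using ((((hS.tendsto_nhdsGE x).comp habs).sub_const x).norm.const_mul M)
  refine tendsto_iff_norm_sub_tendsto_zero.2
    (squeeze_zero' (Eventually.of_forall fun r => norm_nonneg _) ?_ hlim)
  filter_upwards [self_mem_nhdsWithin] with r hr
  rcases le_total s r with h | h
  · exact key s r hs.1 h hs.2
  · rw [norm_sub_rev, abs_sub_comm]
    exact key r s hr.1 h hr.2

lemma IsGenerator.inGenerator {S : ℝ → X →L[ℝ] X} {G : X →ₗ.[ℝ] X} (hG : IsGenerator S G)
    {x y : X} (hxy : (x, y) ∈ G.graph) : InGenerator S x y := by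
  obtain ⟨z, rfl, rfl⟩ := G.mem_graph_iff.1 hxy
  exact hG.1 z

lemma IsGenerator.mem_graph {S : ℝ → X →L[ℝ] X} {G : X →ₗ.[ℝ] X} (hG : IsGenerator S G)
    {x y : X} (hxy : InGenerator S x y) : (x, y) ∈ G.graph := by
  have hx := hG.2 x ⟨y, hxy⟩
  exact G.mem_graph_iff.2 ⟨⟨x, hx⟩, rfl, tendsto_nhds_unique (hG.1 ⟨x, hx⟩) hxy⟩

lemma IsGenerator.apply_mem_graph {S : ℝ → X →L[ℝ] X} {G : X →ₗ.[ℝ] X} (hG : IsGenerator S G)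
    (hS : IsC0Semigroup S) {x y : X} (hxy : (x, y) ∈ G.graph) {s : ℝ} (hs : 0 ≤ s) :
    (S s x, S s y) ∈ G.graph := by
  refine hG.mem_graph ((((S s).continuous.tendsto y).comp (hG.inGenerator hxy)).congr' ?_)
  filter_upwards [self_mem_nhdsWithin] with h hh
  have hh0 : (0 : ℝ) ≤ h := le_of_lt hh
  simp only [Function.comp_apply, map_smul, map_sub]
  rw [← ContinuousLinearMap.comp_apply, ← ContinuousLinearMap.comp_apply,
    ← hS.2.1 _ _ hs hh0, ← hS.2.1 _ _ hh0 hs, add_comm]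

/-- A bounded operator intertwining the generators of two C₀-semigroups intertwines the
semigroups. -/
lemma IsGenerator.intertwine [CompleteSpace X] [CompleteSpace Y]
    {SB : ℝ → X →L[ℝ] X} {B : X →ₗ.[ℝ] X} (hB : IsGenerator SB B) (hSB : IsC0Semigroup SB)
    (hdense : Dense (B.domain : Set X))
    {SC : ℝ → Y →L[ℝ] Y} {C : Y →ₗ.[ℝ] Y} (hC : IsGenerator SC C) (hSC : IsC0Semigroup SC)
    {T : X →L[ℝ] Y} (hT : ∀ x y, (x, y) ∈ B.graph → (T x, T y) ∈ C.graph)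
    {t : ℝ} (ht : 0 ≤ t) (x : X) : T (SB t x) = SC t (T x) := by
  suffices h : ∀ x ∈ (B.domain : Set X), (T.comp (SB t)) x = ((SC t).comp T) x from
    congrFun (Continuous.ext_on hdense (T.comp (SB t)).continuous ((SC t).comp T).continuous h) x
  intro x hx
  obtain ⟨g, hxg⟩ := LinearPMap.mem_domain_iff.1 hx
  obtain ⟨M, hM⟩ := hSC.exists_norm_le t
  set φ : ℝ → Y := fun s => SC (t - s) (T (SB s x)) with hφ
  have hcont : ContinuousOn φ (Icc 0 t) := by
    intro s hs
    have hw : Tendsto (fun r => T (SB r x)) (𝓝[Icc 0 t] s) (𝓝 (T (SB s x))) :=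
      (T.continuous.tendsto _).comp (hSB.continuousOn_apply t x s hs)
    have hv : Tendsto (fun r => SC (t - r) (T (SB s x))) (𝓝[Icc 0 t] s) (𝓝 (φ s)) := by
      have hts : t - s ∈ Icc 0 t := ⟨sub_nonneg.2 hs.2, by linarith [hs.1]⟩
      refine Tendsto.comp (hSC.continuousOn_apply t (T (SB s x)) (t - s) hts)
        (tendsto_nhdsWithin_iff.2 ⟨?_, ?_⟩)
      · exact (Continuous.tendsto (by fun_prop) s).mono_left nhdsWithin_le_nhds
      · filter_upwards [self_mem_nhdsWithin] with r hr
        exact ⟨sub_nonneg.2 hr.2, by linarith [hr.1]⟩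
    have hd : Tendsto (fun r => SC (t - r) (T (SB r x) - T (SB s x))) (𝓝[Icc 0 t] s) (𝓝 0) := by
      have hlim : Tendsto (fun r => M * ‖T (SB r x) - T (SB s x)‖) (𝓝[Icc 0 t] s) (𝓝 0) := by
        simpa using (hw.sub_const (T (SB s x))).norm.const_mul M
      refine squeeze_zero_norm' ?_ hlim
      filter_upwards [self_mem_nhdsWithin] with r hr
      exact (SC (t - r)).le_of_opNorm_le (hM _ ⟨sub_nonneg.2 hr.2, by linarith [hr.1]⟩) _
    have hsum := hd.add hv
    rw [zero_add] at hsum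
    exact hsum.congr fun r => by simp [hφ]
  have hderiv : ∀ s ∈ Ico 0 t, HasDerivWithinAt φ 0 (Ici s) s := by
    intro s hs
    rw [← hasDerivWithinAt_Ioi_iff_Ici, hasDerivWithinAt_iff_tendsto_slope' self_notMem_Ioi]
    have hq := hB.apply_mem_graph hSB hxg hs.1
    set q := SB s x
    set ψ : ℝ → Y := fun h => T (h⁻¹ • (SB h q - q)) - h⁻¹ • (SC h (T q) - T q) with hψ
    have hψ0 : Tendsto ψ (𝓝[>] 0) (𝓝 0) := by
      have := ((T.continuous.tendsto _).comp (hB.inGenerator hq)).sub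
        (hC.inGenerator (hT _ _ hq))
      rwa [sub_self] at this
    have hshift : Tendsto (fun r => r - s) (𝓝[>] s) (𝓝[>] (0 : ℝ)) := by
      refine tendsto_nhdsWithin_iff.2 ⟨?_, ?_⟩
      · have h : Tendsto (fun r : ℝ => r - s) (𝓝 s) (𝓝 (s - s)) :=
          Continuous.tendsto (by fun_prop) s
        rw [sub_self] at h
        exact h.mono_left nhdsWithin_le_nhds
      · filter_upwards [self_mem_nhdsWithin] with r hr
        exact mem_Ioi.2 (sub_pos.2 (mem_Ioi.1 hr))
    have hlim : Tendsto (fun r => M * ‖ψ (r - s)‖) (𝓝[>] s) (𝓝 0) := by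
      simpa using (hψ0.comp hshift).norm.const_mul M
    refine squeeze_zero_norm' ?_ hlim
    filter_upwards [Ioc_mem_nhdsGT hs.2] with r hr
    have hrs : 0 ≤ r - s := sub_nonneg.2 hr.1.le
    have htr : 0 ≤ t - r := sub_nonneg.2 hr.2
    have h1 : SB r x = SB (r - s) q := by
      rw [← ContinuousLinearMap.comp_apply, ← hSB.2.1 _ _ hrs hs.1, sub_add_cancel]
    have h2 : SC (t - s) (T q) = SC (t - r) (SC (r - s) (T q)) := by
      rw [← (SC (t - r)).comp_apply, ← hSC.2.1 _ _ htr hrs, sub_add_sub_cancel]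
    have hslope : slope φ s r = SC (t - r) (ψ (r - s)) := by
      rw [slope_def_module]
      change (r - s)⁻¹ • (SC (t - r) (T (SB r x)) - SC (t - s) (T q)) = _
      rw [h1, h2, ← map_sub, ← map_smul]
      congr 1
      simp only [hψ, map_smul, map_sub, smul_sub]
      abel
    rw [hslope]
    exact (SC (t - r)).le_of_opNorm_le (hM _ ⟨htr, by linarith [hs.1, hr.1]⟩) _
  have hend := constant_of_has_deriv_right_zero hcont hderiv t ⟨ht, le_rfl⟩
  simpa [hφ, hSC.1, hSB.1] using hend

end Semigroup

section Resolvent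

variable {X Y : Type} [NormedAddCommGroup X] [NormedSpace ℝ X]
  [NormedAddCommGroup Y] [NormedSpace ℝ Y]

/-- `R` is the resolvent `(l - G)⁻¹`, as an everywhere defined bounded operator. -/
def IsResolvent (G : X →ₗ.[ℝ] X) (l : ℝ) (R : X →L[ℝ] X) : Prop :=
  (∀ y, (R y, l • R y - y) ∈ G.graph) ∧ ∀ x y, (x, y) ∈ G.graph → R (l • x - y) = x

lemma HilleYosida.exists_resolvent {G : X →ₗ.[ℝ] X} (hG : HilleYosida G) :
    ∃ l0 : ℝ, ∃ R : ℝ → X →L[ℝ] X, ∀ l, l0 < l →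
      IsResolvent G l (R l) ∧ ∀ y, (l - l0) * ‖R l y‖ ≤ ‖y‖ := by
  obtain ⟨-, l0, h⟩ := hG
  have hex : ∀ l, ∃ R : X →L[ℝ] X, l0 < l →
      IsResolvent G l R ∧ ∀ y, (l - l0) * ‖R y‖ ≤ ‖y‖ := by
    intro l
    by_cases hl : l0 < l
    swap
    · exact ⟨0, fun h => absurd h hl⟩
    obtain ⟨hsurj, hbound⟩ := h l hl
    have hpos : 0 < l - l0 := sub_pos.2 hl
    let L : G.domain →ₗ[ℝ] X := l • G.domain.subtype - G.toFun
    have hL : ∀ x : G.domain, L x = l • (x : X) - G x := fun x => rfl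
    have hinj : Function.Injective L := by
      refine (injective_iff_map_eq_zero L).2 fun x hx => ?_
      have := hbound x
      rw [← hL, hx, norm_zero] at this
      have hx0 : ‖(x : X)‖ ≤ 0 := nonpos_of_mul_nonpos_right this hpos
      exact Subtype.ext (norm_le_zero_iff.1 hx0)
    let e : G.domain ≃ₗ[ℝ] X := LinearEquiv.ofBijective L ⟨hinj, hsurj⟩
    have he : ∀ y, l • (e.symm y : X) - G (e.symm y) = y := fun y => e.apply_symm_apply y
    have hb : ∀ y, (l - l0) * ‖(e.symm y : X)‖ ≤ ‖y‖ := fun y => by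
      have := hbound (e.symm y)
      rwa [he] at this
    refine ⟨(G.domain.subtype ∘ₗ (e.symm : X →ₗ[ℝ] G.domain)).mkContinuous (l - l0)⁻¹
      fun y => ?_, fun _ => ⟨⟨fun y => ?_, fun x y hxy => ?_⟩, hb⟩⟩
    · exact (le_inv_mul_iff₀ hpos).2 (hb y)
    · refine G.mem_graph_iff.2 ⟨e.symm y, rfl, ?_⟩
      exact (sub_eq_of_eq_add (sub_eq_iff_eq_add'.1 (he y))).symm
    · obtain ⟨z, rfl, rfl⟩ := G.mem_graph_iff.1 hxy
      exact congrArg Subtype.val (e.symm_apply_apply z)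
  choose R hR using hex
  exact ⟨l0, R, hR⟩

lemma IsResolvent.smul_apply_sub {G : X →ₗ.[ℝ] X} {l : ℝ} {R : X →L[ℝ] X}
    (hR : IsResolvent G l R) {x y : X} (hxy : (x, y) ∈ G.graph) : l • R x - x = R y := by
  have := hR.2 x y hxy
  rw [map_sub, map_smul] at this
  rw [sub_eq_iff_eq_add, ← sub_eq_iff_eq_add', this]

/-- The operators `l (l - G)⁻¹` converge strongly to the identity as `l → ∞`. -/
lemma tendsto_smul_resolvent {G : X →ₗ.[ℝ] X} (hdense : Dense (G.domain : Set X))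
    {l0 : ℝ} {R : ℝ → X →L[ℝ] X}
    (hR : ∀ l, l0 < l → IsResolvent G l (R l) ∧ ∀ y, (l - l0) * ‖R l y‖ ≤ ‖y‖) (x : X) :
    Tendsto (fun l : ℝ => l • R l x) atTop (𝓝 x) := by
  rw [Metric.tendsto_nhds]
  intro ε hε
  obtain ⟨z, hz, hxz⟩ := hdense.exists_dist_lt x (show 0 < ε / 4 by positivity)
  obtain ⟨g, hzg⟩ := LinearPMap.mem_domain_iff.1 hz
  rw [dist_eq_norm] at hxz
  filter_upwards [eventually_gt_atTop l0, eventually_ge_atTop (2 * l0), eventually_ge_atTop 0,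
    eventually_gt_atTop (l0 + 4 * ‖g‖ / ε)] with l hl hl2 hl0 hlg
  obtain ⟨hres, hb⟩ := hR l hl
  have hpos : 0 < l - l0 := sub_pos.2 hl
  have h1 : ‖l • R l (x - z)‖ ≤ 2 * ‖x - z‖ := by
    rw [norm_smul, Real.norm_of_nonneg hl0]
    nlinarith [hb (x - z), norm_nonneg (R l (x - z))]
  have h2 : ‖l • R l z - z‖ < ε / 4 := by
    rw [hres.smul_apply_sub hzg]
    have hg : 4 * ‖g‖ < (l - l0) * ε := (div_lt_iff₀ hε).1 (by linarith)
    refine lt_of_mul_lt_mul_left ((hb g).trans_lt ?_) hpos.le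
    linarith
  have h3 : l • R l x - x = l • R l (x - z) + (l • R l z - z) - (x - z) := by
    rw [map_sub, smul_sub]
    abel
  rw [dist_eq_norm, h3]
  have h4 := norm_sub_le (l • R l (x - z) + (l • R l z - z)) (x - z)
  have h5 := norm_add_le (l • R l (x - z)) (l • R l z - z)
  linarith

/-- A closed operator composed with a bounded operator with values in its domain is bounded. -/
lemma LinearPMap.IsClosed.exists_comp [CompleteSpace X] [CompleteSpace Y] {A : X →ₗ.[ℝ] Y}
    (hA : A.IsClosed) (R : X →L[ℝ] X) (hR : ∀ x, R x ∈ A.domain) :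
    ∃ T : X →L[ℝ] Y, ∀ x, (R x, T x) ∈ A.graph := by
  let T : X →ₗ[ℝ] Y := A.toFun ∘ₗ (R : X →ₗ[ℝ] X).codRestrict A.domain hR
  have hT : ∀ x, (R x, T x) ∈ A.graph := fun x => A.mem_graph ⟨R x, hR x⟩
  have hgraph : (T.graph : Set (X × Y)) = (fun p : X × Y => (R p.1, p.2)) ⁻¹' A.graph := by
    ext ⟨x, y⟩
    refine ⟨fun h => ?_, fun h => ?_⟩
    · have hy : y = T x := h
      rw [hy]
      exact hT x
    · exact A.mem_graph_snd_inj h (hT x) rfl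
  have hclosed : _root_.IsClosed (T.graph : Set (X × Y)) := by
    rw [hgraph]
    exact hA.preimage (by fun_prop)
  exact ⟨ContinuousLinearMap.ofIsClosedGraph hclosed, hT⟩

end Resolvent

/-- if `A : X ⇸ Y` is closed, `B`, `C` are densely defined operators
satisfying the Hille–Yosida condition generating the C₀-semigroups `(e^{tB})`, `(e^{tC})`,
`Dom B ⊆ Dom A` and `C ∘ A` extends `A ∘ B`, then for `t > 0`, `A ∘ e^{tB}` extends
`e^{tC} ∘ A`. -/
theorem stmt18 {X Y : Type}
    [NormedAddCommGroup X] [NormedSpace ℝ X] [CompleteSpace X]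
    [NormedAddCommGroup Y] [NormedSpace ℝ Y] [CompleteSpace Y]
    (A : X →ₗ.[ℝ] Y) (hA : A.IsClosed)
    (B : X →ₗ.[ℝ] X) (C : Y →ₗ.[ℝ] Y)
    (hB : HilleYosida B) (hC : HilleYosida C)
    (SB : ℝ → X →L[ℝ] X) (hSB : IsC0Semigroup SB) (hgenB : IsGenerator SB B)
    (SC : ℝ → Y →L[ℝ] Y) (hSC : IsC0Semigroup SC) (hgenC : IsGenerator SC C)
    (hsub : ∀ x : B.domain, (x : X) ∈ A.domain)
    (hext : ∀ (x : B.domain) (hBx : B x ∈ A.domain),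
      ∃ hAx : A ⟨(x : X), hsub x⟩ ∈ C.domain,
        C ⟨A ⟨(x : X), hsub x⟩, hAx⟩ = A ⟨B x, hBx⟩) :
    ∀ t : ℝ, 0 < t → ∀ x : A.domain,
      ∃ h : SB t (x : X) ∈ A.domain, A ⟨SB t (x : X), h⟩ = SC t (A x) := by
  have hgraph : ∀ x b a c, (x, b) ∈ B.graph → (x, a) ∈ A.graph → (b, c) ∈ A.graph →
      (a, c) ∈ C.graph := by
    intro x b a c hxb hxa hbc
    obtain ⟨x, rfl, rfl⟩ := B.mem_graph_iff.1 hxb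
    obtain ⟨hAx, hCA⟩ := hext x (LinearPMap.mem_domain_of_mem_graph hbc)
    have ha : a = A ⟨x, hsub x⟩ := A.mem_graph_snd_inj hxa (A.mem_graph _) rfl
    have hc : c = A ⟨B x, LinearPMap.mem_domain_of_mem_graph hbc⟩ :=
      A.mem_graph_snd_inj hbc (A.mem_graph _) rfl
    rw [ha, hc, ← hCA]
    exact C.mem_graph ⟨_, hAx⟩
  obtain ⟨l1, RB, hRB⟩ := hB.exists_resolvent
  obtain ⟨l2, RC, hRC⟩ := hC.exists_resolvent
  intro t ht x
  have key : ∀ l, l1 < l → l2 < l →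
      (l • RB l (SB t x), SC t (l • RC l (A x))) ∈ A.graph := by
    intro l hl1 hl2
    have hres := (hRB l hl1).1
    obtain ⟨T, hT⟩ := hA.exists_comp (RB l) fun y =>
      hsub ⟨_, LinearPMap.mem_domain_of_mem_graph (hres.1 y)⟩
    have hTR : T x = RC l (A x) := by
      have h1 := hgraph _ _ _ _ (hres.1 x) (hT x)
        (A.graph.sub_mem (A.graph.smul_mem l (hT x)) (A.mem_graph x))
      have h2 := (hRC l hl2).1.2 _ _ h1
      rw [← h2]
      exact congrArg (RC l) (sub_sub_cancel (l • T x) (A x))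
    have hTS : T (SB t x) = SC t (T x) := by
      refine hgenB.intertwine hSB hB.1 hgenC hSC (fun y z hyz => ?_) ht.le x
      refine hgraph _ _ _ _ (hres.1 y) (hT y) ?_
      rw [hres.smul_apply_sub hyz]
      exact hT z
    rw [map_smul, ← hTR, ← hTS]
    exact A.graph.smul_mem l (hT _)
  have hmem : (SB t x, SC t (A x)) ∈ A.graph := by
    have hlim := (tendsto_smul_resolvent hB.1 hRB (SB t x)).prodMk_nhds
      (((SC t).continuous.tendsto _).comp (tendsto_smul_resolvent hC.1 hRC (A x)))
    refine IsClosed.mem_of_tendsto hA hlim ?_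
    filter_upwards [eventually_gt_atTop l1, eventually_gt_atTop l2] with l hl1 hl2
    exact key l hl1 hl2
  have hdom := LinearPMap.mem_domain_of_mem_graph hmem
  exact ⟨hdom, A.mem_graph_snd_inj (A.mem_graph ⟨_, hdom⟩) hmem rfl⟩
end
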